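/- Borel Lemma, logarithmic form: Let T be a strictly positive nondecreasing function of class C^1 on (0,∞) and let γ > 0 be a number such that T(γ) ≥ e. Then for every δ > 0, the inequality T'(r) ≤ T(r)·(log T(r))^{1+δ} holds for all r ≥ γ outside a set E_δ ⊂ (0,∞) of finite Lebesgue measure; more precisely, the Lebesgue measure of E_δ is at most ∫_e^∞ dt/(t·(log t)^{1+δ}) = 1/δ. -/

import Mathlib

open MeasureTheory Set

lemma aux_hasDerivAt (δ : ℝ) (hδ : 0 < δ) (t : ℝ) (ht : Real.exp 1 ≤ t) :
    HasDerivAt (fun t => -(1 / δ) * Real.log t ^ (-δ)) (1 / (t * Real.log t ^ (1 + δ))) t := by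
  have ht0 : 0 < t := (Real.exp_pos 1).trans_le ht
  have hl : 1 ≤ Real.log t := (Real.le_log_iff_exp_le ht0).2 ht
  have hl0 : 0 < Real.log t := by linarith
  have h := ((Real.hasDerivAt_log ht0.ne').rpow_const (p := -δ) (Or.inl hl0.ne')).const_mul
    (-(1 / δ))
  refine h.congr_deriv ?_
  have e : -δ - 1 = -(1 + δ) := by ring
  rw [e, Real.rpow_neg hl0.le]
  have := (Real.rpow_pos_of_pos hl0 (1 + δ)).ne'
  field_simp

/-- **Borel Lemma, logarithmic form.** Let `T` be a strictly positive nondecreasing `C¹`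
function on `(0,∞)` and `γ > 0` with `T γ ≥ e`.  Then for every `δ > 0`, the inequality
`T' r ≤ T r * (log T r)^(1+δ)` holds for all `r ≥ γ` outside a set of finite Lebesgue
measure; more precisely, the measure of the exceptional set is at most
`∫_e^∞ dt/(t (log t)^(1+δ)) = 1/δ`. -/
theorem borel_lemma_log (T : ℝ → ℝ) (γ : ℝ) (hγ : 0 < γ)
    (hT1 : ContDiffOn ℝ 1 T (Set.Ioi 0))
    (hTpos : ∀ r ∈ Set.Ioi (0:ℝ), 0 < T r)
    (hTmono : MonotoneOn T (Set.Ioi 0))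
    (hTγ : Real.exp 1 ≤ T γ)
    (δ : ℝ) (hδ : 0 < δ) :
    (∫ t in Set.Ici (Real.exp 1), 1 / (t * Real.log t ^ (1 + δ))) = 1 / δ ∧
    volume {r : ℝ | r ∈ Set.Ici γ ∧ T r * Real.log (T r) ^ (1 + δ) < deriv T r}
      ≤ ENNReal.ofReal (1 / δ) := by
  have hpos : ∀ t, Real.exp 1 ≤ t → 0 < t * Real.log t ^ (1 + δ) := by
    intro t ht
    have ht0 : 0 < t := (Real.exp_pos 1).trans_le ht
    have hl : 1 ≤ Real.log t := (Real.le_log_iff_exp_le ht0).2 ht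
    have hl0 : 0 < Real.log t := by linarith
    positivity
  constructor
  · rw [integral_Ici_eq_integral_Ioi]
    rw [integral_Ioi_of_hasDerivAt_of_nonneg' (l := 0)
      (fun t ht => aux_hasDerivAt δ hδ t ht)
      (fun t ht => (one_div_pos.2 (hpos t (le_of_lt ht))).le)]
    · simp
    · have := ((tendsto_rpow_neg_atTop hδ).comp Real.tendsto_log_atTop).const_mul (-(1 / δ))
      simpa using this
  · set G : ℝ → ℝ := fun t => -(1 / δ) * Real.log t ^ (-δ) with hG
    set g' : ℝ → ℝ := fun r => 1 / (T r * Real.log (T r) ^ (1 + δ)) * deriv T r with hg'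
    have hTe : ∀ r, γ ≤ r → Real.exp 1 ≤ T r := fun r hr =>
      hTγ.trans (hTmono hγ (hγ.trans_le hr) hr)
    have hTd : ∀ r, γ ≤ r → HasDerivAt T (deriv T r) r := fun r hr =>
      ((hT1.differentiableOn (by norm_num)).differentiableAt
        (Ioi_mem_nhds (hγ.trans_le hr))).hasDerivAt
    have hgd : ∀ r ∈ Ici γ, HasDerivAt (G ∘ T) (g' r) r := fun r hr =>
      (aux_hasDerivAt δ hδ (T r) (hTe r hr)).comp r (hTd r hr)
    have hd0 : ∀ r, γ ≤ r → 0 ≤ deriv T r := by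
      intro r hr
      have hr0 : r ∈ Ioi (0:ℝ) := hγ.trans_le hr
      rw [← derivWithin_of_isOpen isOpen_Ioi hr0]
      exact hTmono.derivWithin_nonneg
    have hg0 : ∀ r ∈ Ioi γ, 0 ≤ g' r := fun r hr =>
      mul_nonneg (one_div_pos.2 (hpos _ (hTe r (le_of_lt hr)))).le (hd0 r (le_of_lt hr))
    have hlog : ∀ t, Real.exp 1 ≤ t → 1 ≤ Real.log t := fun t ht =>
      (Real.le_log_iff_exp_le ((Real.exp_pos 1).trans_le ht)).2 ht
    have hGmono : ∀ s t, Real.exp 1 ≤ s → s ≤ t → G s ≤ G t := by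
      intro s t hs hst
      have h1 := hlog s hs
      have h2 : Real.log s ≤ Real.log t := Real.log_le_log ((Real.exp_pos 1).trans_le hs) hst
      have h3 : Real.log t ^ (-δ) ≤ Real.log s ^ (-δ) :=
        Real.rpow_le_rpow_of_nonpos (by linarith) h2 (by linarith)
      have h4 : 0 < 1 / δ := by positivity
      simp only [hG]
      nlinarith
    have hG0 : ∀ t, Real.exp 1 ≤ t → G t ≤ 0 := by
      intro t ht
      have h1 := hlog t ht
      have h3 : 0 ≤ Real.log t ^ (-δ) := Real.rpow_nonneg (by linarith) _
      have h4 : 0 < 1 / δ := by positivity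
      simp only [hG]
      nlinarith
    have hGγ : -(1 / δ) ≤ G (T γ) := by
      have h := hGmono _ _ le_rfl hTγ
      simpa [hG] using h
    have hmono : Monotone (fun r => G (T (max r γ))) := by
      intro a b hab
      refine hGmono _ _ (hTe _ (le_max_right _ _)) (hTmono ?_ ?_ (max_le_max_right _ hab))
      · exact hγ.trans_le (le_max_right _ _)
      · exact hγ.trans_le (le_max_right _ _)
    have hbdd : BddAbove (range (fun r => G (T (max r γ)))) :=
      ⟨0, by rintro _ ⟨r, rfl⟩; exact hG0 _ (hTe _ (le_max_right _ _))⟩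
    have hlim := tendsto_atTop_ciSup hmono hbdd
    set l := ⨆ r, G (T (max r γ)) with hl
    have hl0 : l ≤ 0 := ciSup_le fun r => hG0 _ (hTe _ (le_max_right _ _))
    have hlim' : Filter.Tendsto (G ∘ T) Filter.atTop (nhds l) := by
      refine hlim.congr' ?_
      filter_upwards [Filter.eventually_ge_atTop γ] with r hr
      simp [max_eq_left hr]
    have hgi := integrableOn_Ioi_deriv_of_nonneg' hgd hg0 hlim'
    have hval := integral_Ioi_of_hasDerivAt_of_nonneg' hgd hg0 hlim'
    have hgi' : IntegrableOn g' (Ici γ) := (integrableOn_Ici_iff_integrableOn_Ioi (by simp)).2 hgi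
    set E := {r : ℝ | r ∈ Set.Ici γ ∧ T r * Real.log (T r) ^ (1 + δ) < deriv T r} with hE
    calc volume E = volume.restrict (Ici γ) E :=
          (Measure.restrict_eq_self _ (fun r hr => hr.1)).symm
      _ ≤ volume.restrict (Ici γ) {r | 1 ≤ ENNReal.ofReal (g' r)} := by
          refine measure_mono ?_
          rintro r ⟨hr, h⟩
          have hp := hpos _ (hTe r hr)
          simp only [mem_ofPred_eq, ENNReal.one_le_ofReal, hg']
          rw [one_div_mul_eq_div, le_div_iff₀ hp]
          linarith
      _ ≤ ∫⁻ r in Ici γ, ENNReal.ofReal (g' r) := by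
          have := mul_meas_ge_le_lintegral₀ (μ := volume.restrict (Ici γ))
            hgi'.aemeasurable.ennreal_ofReal 1
          simpa only [one_mul] using this
      _ = ENNReal.ofReal (∫ r in Ioi γ, g' r) := by
          rw [ofReal_integral_eq_lintegral_ofReal hgi
            ((ae_restrict_iff' measurableSet_Ioi).2 (Filter.Eventually.of_forall hg0)),
            restrict_Ioi_eq_restrict_Ici]
      _ ≤ ENNReal.ofReal (1 / δ) := by
          refine ENNReal.ofReal_le_ofReal ?_
          rw [hval, Function.comp]
          linarith
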